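/- (Priority relation properties.) Let φ be a feasible path and ≻ the priority relation it induces. For all i, j ∈ R with χ^obs_{ij} ≠ ∅, exactly one of i ≻ j and j ≻ i holds; and for all i, j ∈ R with χ^obs_{ij} = ∅, i ≻ j does not hold. -/

import Mathlib

open Set

noncomputable section

/-- Canonical basis vector `e i` of the coordination space `ℝ^n`. -/
def basisVec (n : ℕ) (i : Fin n) : Fin n → ℝ := Pi.single i 1

/-- Collision cylinder `χ^obs_{ij} = {x : (x i, x j) ∈ κ i j}`. -/
def cyl (n : ℕ) (κ : Fin n → Fin n → Set (ℝ × ℝ)) (i j : Fin n) : Set (Fin n → ℝ) :=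
  {x | (x i, x j) ∈ κ i j}

/-- Completed cylinder `χ^obs_{i≻j} = χ^obs_{ij} − ℝ₊ e_i + ℝ₊ e_j` (Minkowski sums). -/
def cylPr (n : ℕ) (κ : Fin n → Fin n → Set (ℝ × ℝ)) (i j : Fin n) : Set (Fin n → ℝ) :=
  {z | ∃ y ∈ cyl n κ i j, ∃ a b : ℝ, 0 ≤ a ∧ 0 ≤ b ∧
    z = y - a • basisVec n i + b • basisVec n j}

/-- Obstacle region `χ^obs = ⋃_{i,j} χ^obs_{ij}`. -/
def obsRegion (n : ℕ) (κ : Fin n → Fin n → Set (ℝ × ℝ)) : Set (Fin n → ℝ) :=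
  ⋃ i, ⋃ j, cyl n κ i j

/-- Obstacle-free region `χ^free = χ \ χ^obs`. -/
def freeRegion (n : ℕ) (κ : Fin n → Fin n → Set (ℝ × ℝ)) : Set (Fin n → ℝ) :=
  (obsRegion n κ)ᶜ

/-- Standing hypotheses on the collision data `κ`: each `κ i j` is open, bounded and
convex, `κ i i = ∅`, and `(a,b) ∈ κ i j ↔ (b,a) ∈ κ j i`. -/
def KappaHyp (n : ℕ) (κ : Fin n → Fin n → Set (ℝ × ℝ)) : Prop :=
  (∀ i j, IsOpen (κ i j)) ∧ (∀ i j, Bornology.IsBounded (κ i j)) ∧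
  (∀ i j, Convex ℝ (κ i j)) ∧ (∀ i, κ i i = ∅) ∧
  (∀ (i j : Fin n) (a b : ℝ), (a, b) ∈ κ i j ↔ (b, a) ∈ κ j i)

/-- `PhiMem n C φ` : `φ` restricted to `[0,1]` is a continuous nondecreasing path whose
image lies in `C`, with `φ 0 − ℝ₊^n ⊆ C` and `φ 1 + ℝ₊^n ⊆ C` (the set `Φ(C)`). -/
def PhiMem (n : ℕ) (C : Set (Fin n → ℝ)) (φ : ℝ → Fin n → ℝ) : Prop :=
  ContinuousOn φ (Icc 0 1) ∧
  (∀ t1 ∈ Icc (0:ℝ) 1, ∀ t2 ∈ Icc (0:ℝ) 1, t1 ≤ t2 → φ t1 ≤ φ t2) ∧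
  (∀ t ∈ Icc (0:ℝ) 1, φ t ∈ C) ∧
  (∀ d : Fin n → ℝ, 0 ≤ d → φ 0 - d ∈ C) ∧
  (∀ d : Fin n → ℝ, 0 ≤ d → φ 1 + d ∈ C)

/-- The priority relation induced by a path `φ`: `i ≻ j` iff the image of `φ` (on
`[0,1]`) meets `χ^obs_{j≻i}`. -/
def Pri (n : ℕ) (κ : Fin n → Fin n → Set (ℝ × ℝ)) (φ : ℝ → Fin n → ℝ)
    (i j : Fin n) : Prop :=
  ∃ t ∈ Icc (0:ℝ) 1, φ t ∈ cylPr n κ j i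

/-- A point of the line through `p` and `q` whose second coordinate lies between those of
`p` and `q` belongs to every convex set containing `p` and `q`. -/
theorem Convex.mem_of_collinear_of_snd_between {K : Set (ℝ × ℝ)} (hK : Convex ℝ K)
    {p q r : ℝ × ℝ} (hp : p ∈ K) (hq : q ∈ K) (hpq : p.2 < q.2)
    (hr : (r.1 - p.1) * (q.2 - p.2) = (r.2 - p.2) * (q.1 - p.1))
    (h1 : p.2 ≤ r.2) (h2 : r.2 ≤ q.2) : r ∈ K := by
  have hpos : 0 < q.2 - p.2 := sub_pos.2 hpq
  have hmem := hK hp hq (a := (q.2 - r.2) / (q.2 - p.2)) (b := (r.2 - p.2) / (q.2 - p.2))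
    (div_nonneg (by linarith) hpos.le) (div_nonneg (by linarith) hpos.le)
    (by field_simp; ring)
  convert hmem using 1
  ext
  · simp only [Prod.fst_add, Prod.smul_fst, smul_eq_mul]
    field_simp
    linarith
  · simp only [Prod.snd_add, Prod.smul_snd, smul_eq_mul]
    field_simp
    ring

/-- A monotone planar path avoiding a convex set `K`, not starting above a point of `K` and not
ending below one, cannot be weakly above-left of a point of `K` and later weakly below-right
of a point of `K`. -/
theorem not_aboveLeft_then_belowRight {K : Set (ℝ × ℝ)} (hK : Convex ℝ K) {x y : ℝ → ℝ}
    (hxc : ContinuousOn x (Icc 0 1)) (hyc : ContinuousOn y (Icc 0 1))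
    (hxm : MonotoneOn x (Icc 0 1)) (hym : MonotoneOn y (Icc 0 1))
    (hfree : ∀ t ∈ Icc (0 : ℝ) 1, (x t, y t) ∉ K)
    (hstart : ∀ k ∈ K, k.1 ≤ x 0 → ¬ k.2 ≤ y 0)
    (hend : ∀ k ∈ K, x 1 ≤ k.1 → ¬ y 1 ≤ k.2)
    {s t : ℝ} (hs : s ∈ Icc (0 : ℝ) 1) (ht : t ∈ Icc (0 : ℝ) 1) (hst : s ≤ t)
    {p q : ℝ × ℝ} (hp : p ∈ K) (hq : q ∈ K) (hsx : x s ≤ p.1) (hsy : p.2 ≤ y s)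
    (htx : q.1 ≤ x t) (hty : y t ≤ q.2) : False := by
  have h0 : (0 : ℝ) ∈ Icc (0 : ℝ) 1 := by simp
  have h1 : (1 : ℝ) ∈ Icc (0 : ℝ) 1 := by simp
  have hyst := hym hs ht hst
  have hsub : Icc s t ⊆ Icc (0 : ℝ) 1 := Icc_subset_Icc hs.1 ht.2
  rcases (hsy.trans (hyst.trans hty)).eq_or_lt with hpq | hpq
  · rcases le_total q.1 (x s) with hqs | hqs
    · refine hfree s hs (hK.segment_subset hq hp ?_)
      have hy : y s = q.2 := by linarith
      rw [hy, show q = (q.1, q.2) from rfl, show p = (p.1, q.2) by rw [← hpq],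
        ← Prod.image_mk_segment_left, segment_eq_Icc (hqs.trans hsx)]
      exact ⟨x s, ⟨hqs, hsx⟩, rfl⟩
    · obtain ⟨u, hu, hux⟩ := intermediate_value_Icc hst (hxc.mono hsub) ⟨hqs, htx⟩
      have hsu := hym hs (hsub hu) hu.1
      have hut := hym (hsub hu) ht hu.2
      refine hfree u (hsub hu) ?_
      have hy : y u = q.2 := by linarith
      rwa [hux, hy]
  have hline : ∀ u ∈ Icc (0 : ℝ) 1,
      (x u - p.1) * (q.2 - p.2) - (y u - p.2) * (q.1 - p.1) = 0 →
      p.2 ≤ y u → y u ≤ q.2 → False := fun u hu he hl hr ↦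
    hfree u hu (hK.mem_of_collinear_of_snd_between hp hq hpq
      (by simpa using sub_eq_zero.1 he) hl hr)
  have hcont : ContinuousOn
      (fun u ↦ (x u - p.1) * (q.2 - p.2) - (y u - p.2) * (q.1 - p.1)) (Icc 0 1) := by fun_prop
  rcases le_or_gt p.1 q.1 with hx | hx
  · obtain ⟨u, hu, hu0⟩ := intermediate_value_Icc hst (hcont.mono hsub)
      (show (0 : ℝ) ∈ _ from ⟨by nlinarith, by nlinarith⟩)
    exact hline u (hsub hu) hu0 (hsy.trans (hym hs (hsub hu) hu.1))
      ((hym (hsub hu) ht hu.2).trans hty)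
  -- At height `v`, the segment from `p` to `q` has abscissa `p.1 + (v - p.2) * m`.
  set m := (q.1 - p.1) / (q.2 - p.2) with hm
  have hpos : 0 < q.2 - p.2 := sub_pos.2 hpq
  have hmq : m * (q.2 - p.2) = q.1 - p.1 := by rw [hm]; field_simp
  have hseg : ∀ v, p.2 ≤ v → v ≤ q.2 → (p.1 + (v - p.2) * m, v) ∈ K := fun v hl hr ↦
    hK.mem_of_collinear_of_snd_between hp hq hpq
      (by simp only; linear_combination (v - p.2) * hmq) hl hr
  have hf0 : (x 0 - p.1) * (q.2 - p.2) - (y 0 - p.2) * (q.1 - p.1) ≤ 0 := by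
    by_contra! hneg
    have hx0 := (hxm h0 hs hs.1).trans hsx
    have hy0 := (hym h0 ht ht.1).trans hty
    have hpy : p.2 ≤ y 0 := by by_contra! h; nlinarith
    refine hstart _ (hseg (y 0) hpy hy0) ?_ le_rfl
    by_contra! h
    simp only at h
    nlinarith
  have hf1 : 0 ≤ (x 1 - p.1) * (q.2 - p.2) - (y 1 - p.2) * (q.1 - p.1) := by
    by_contra! hneg
    have hx1 := htx.trans (hxm ht h1 ht.2)
    have hy1 := hsy.trans (hym hs h1 hs.2)
    have hyq : y 1 ≤ q.2 := by by_contra! h; nlinarith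
    refine hend _ (hseg (y 1) hy1 hyq) ?_ le_rfl
    by_contra! h
    simp only at h
    nlinarith
  obtain ⟨u, hu, hu0⟩ := intermediate_value_Icc zero_le_one hcont ⟨hf0, hf1⟩
  simp only at hu0
  refine hline u hu hu0 ?_ ?_
  · rcases le_total s u with hsu | hus
    · exact hsy.trans (hym hs hu hsu)
    · have := (hxm hu hs hus).trans hsx
      by_contra! h
      nlinarith
  · rcases le_total u t with hut | htu
    · exact (hym hu ht hut).trans hty
    · have := htx.trans (hxm ht hu htu)
      by_contra! h
      nlinarith

theorem mem_cylPr_iff {n : ℕ} {κ : Fin n → Fin n → Set (ℝ × ℝ)} {i j : Fin n} (hij : i ≠ j)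
    {z : Fin n → ℝ} : z ∈ cylPr n κ i j ↔ ∃ k ∈ κ i j, z i ≤ k.1 ∧ k.2 ≤ z j := by
  constructor
  · rintro ⟨w, hw, a, b, ha, hb, rfl⟩
    exact ⟨_, hw, by simp [basisVec, hij, ha], by simp [basisVec, hij.symm, hb]⟩
  · rintro ⟨k, hk, h1, h2⟩
    refine ⟨z + (k.1 - z i) • basisVec n i - (z j - k.2) • basisVec n j, ?_,
      k.1 - z i, z j - k.2, by linarith, by linarith, by abel⟩
    simpa [cyl, basisVec, hij, hij.symm] using hk

theorem pri_iff {n : ℕ} {κ : Fin n → Fin n → Set (ℝ × ℝ)} (hκ : KappaHyp n κ)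
    {φ : ℝ → Fin n → ℝ} {i j : Fin n} (hij : i ≠ j) :
    Pri n κ φ i j ↔ ∃ t ∈ Icc (0 : ℝ) 1, ∃ k ∈ κ i j, k.1 ≤ φ t i ∧ φ t j ≤ k.2 := by
  simp only [Pri, mem_cylPr_iff hij.symm]
  refine exists_congr fun t ↦ and_congr_right fun _ ↦ ?_
  constructor <;> rintro ⟨k, hk, h1, h2⟩ <;>
    exact ⟨k.swap, (hκ.2.2.2.2 _ _ _ _).1 hk, h2, h1⟩

theorem notMem_of_mem_freeRegion {n : ℕ} {κ : Fin n → Fin n → Set (ℝ × ℝ)} {z : Fin n → ℝ}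
    (hz : z ∈ freeRegion n κ) (i j : Fin n) : (z i, z j) ∉ κ i j :=
  fun h ↦ hz (mem_iUnion₂.2 ⟨i, j, h⟩)

theorem PhiMem.not_le_start {n : ℕ} {κ : Fin n → Fin n → Set (ℝ × ℝ)} {φ : ℝ → Fin n → ℝ}
    (hφ : PhiMem n (freeRegion n κ) φ) {i j : Fin n} (hij : i ≠ j) {k : ℝ × ℝ}
    (hk : k ∈ κ i j) (h1 : k.1 ≤ φ 0 i) : ¬ k.2 ≤ φ 0 j := fun h2 ↦ by
  refine notMem_of_mem_freeRegion (hφ.2.2.2.1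
    (Pi.single i (φ 0 i - k.1) + Pi.single j (φ 0 j - k.2)) (add_nonneg ?_ ?_)) i j ?_
  · exact Pi.single_nonneg.2 (sub_nonneg.2 h1)
  · exact Pi.single_nonneg.2 (sub_nonneg.2 h2)
  · simpa [hij, hij.symm] using hk

theorem PhiMem.not_end_le {n : ℕ} {κ : Fin n → Fin n → Set (ℝ × ℝ)} {φ : ℝ → Fin n → ℝ}
    (hφ : PhiMem n (freeRegion n κ) φ) {i j : Fin n} (hij : i ≠ j) {k : ℝ × ℝ}
    (hk : k ∈ κ i j) (h1 : φ 1 i ≤ k.1) : ¬ φ 1 j ≤ k.2 := fun h2 ↦ by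
  refine notMem_of_mem_freeRegion (hφ.2.2.2.2
    (Pi.single i (k.1 - φ 1 i) + Pi.single j (k.2 - φ 1 j)) (add_nonneg ?_ ?_)) i j ?_
  · exact Pi.single_nonneg.2 (sub_nonneg.2 h1)
  · exact Pi.single_nonneg.2 (sub_nonneg.2 h2)
  · simpa [hij, hij.symm] using hk

theorem PhiMem.continuousOn_apply {n : ℕ} {C : Set (Fin n → ℝ)} {φ : ℝ → Fin n → ℝ}
    (hφ : PhiMem n C φ) (i : Fin n) : ContinuousOn (fun t ↦ φ t i) (Icc 0 1) :=
  continuousOn_pi.1 hφ.1 i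

theorem PhiMem.monotoneOn_apply {n : ℕ} {C : Set (Fin n → ℝ)} {φ : ℝ → Fin n → ℝ}
    (hφ : PhiMem n C φ) (i : Fin n) : MonotoneOn (fun t ↦ φ t i) (Icc 0 1) :=
  fun _ ha _ hb hab ↦ hφ.2.1 _ ha _ hb hab i

theorem PhiMem.not_aboveLeft_then_belowRight {n : ℕ} {κ : Fin n → Fin n → Set (ℝ × ℝ)}
    (hκ : KappaHyp n κ) {φ : ℝ → Fin n → ℝ} (hφ : PhiMem n (freeRegion n κ) φ) {i j : Fin n}
    (hij : i ≠ j) {s t : ℝ} (hs : s ∈ Icc (0 : ℝ) 1) (ht : t ∈ Icc (0 : ℝ) 1) (hst : s ≤ t)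
    {p q : ℝ × ℝ} (hp : p ∈ κ i j) (hq : q ∈ κ i j) (hsx : φ s i ≤ p.1) (hsy : p.2 ≤ φ s j)
    (htx : q.1 ≤ φ t i) (hty : φ t j ≤ q.2) : False :=
  _root_.not_aboveLeft_then_belowRight (hκ.2.2.1 i j) (hφ.continuousOn_apply i)
    (hφ.continuousOn_apply j) (hφ.monotoneOn_apply i) (hφ.monotoneOn_apply j)
    (fun u hu ↦ notMem_of_mem_freeRegion (hφ.2.2.1 u hu) i j)
    (fun _ ↦ hφ.not_le_start hij) (fun _ ↦ hφ.not_end_le hij) hs ht hst hp hq hsx hsy htx hty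

theorem not_pri_and_pri {n : ℕ} {κ : Fin n → Fin n → Set (ℝ × ℝ)} (hκ : KappaHyp n κ)
    {φ : ℝ → Fin n → ℝ} (hφ : PhiMem n (freeRegion n κ) φ) {i j : Fin n} (hij : i ≠ j) :
    ¬ (Pri n κ φ i j ∧ Pri n κ φ j i) := by
  rw [pri_iff hκ hij, pri_iff hκ hij.symm]
  rintro ⟨⟨t, ht, q, hq, hq1, hq2⟩, s, hs, p, hp, hp1, hp2⟩
  have swap_mem : ∀ {a b : Fin n} {k : ℝ × ℝ}, k ∈ κ a b → k.swap ∈ κ b a :=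
    fun hk ↦ (hκ.2.2.2.2 _ _ _ _).1 hk
  rcases le_total s t with hst | hts
  · exact hφ.not_aboveLeft_then_belowRight hκ hij hs ht hst (swap_mem hp) hq hp2 hp1 hq1 hq2
  · exact hφ.not_aboveLeft_then_belowRight hκ hij.symm ht hs hts (swap_mem hq) hp hq2 hq1 hp1 hp2

theorem pri_or_pri {n : ℕ} {κ : Fin n → Fin n → Set (ℝ × ℝ)} (hκ : KappaHyp n κ)
    {φ : ℝ → Fin n → ℝ} (hφ : PhiMem n (freeRegion n κ) φ) {i j : Fin n} (hij : i ≠ j)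
    {k : ℝ × ℝ} (hk : k ∈ κ i j) : Pri n κ φ i j ∨ Pri n κ φ j i := by
  have h0 : (0 : ℝ) ∈ Icc (0 : ℝ) 1 := by simp
  have h1 : (1 : ℝ) ∈ Icc (0 : ℝ) 1 := by simp
  have hk' : k.swap ∈ κ j i := (hκ.2.2.2.2 _ _ _ _).1 hk
  rw [pri_iff hκ hij, pri_iff hκ hij.symm]
  rcases le_total k.1 (φ 0 i) with hs | hs
  · exact .inl ⟨0, h0, k, hk, hs, (not_le.1 (hφ.not_le_start hij hk hs)).le⟩
  rcases le_total (φ 1 i) k.1 with he | he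
  · exact .inr ⟨1, h1, k.swap, hk', (not_le.1 (hφ.not_end_le hij hk he)).le, he⟩
  obtain ⟨u, hu, hui⟩ := intermediate_value_Icc zero_le_one (hφ.continuousOn_apply i) ⟨hs, he⟩
  simp only at hui
  rcases le_total (φ u j) k.2 with hj | hj
  · exact .inl ⟨u, hu, k, hk, hui.ge, hj⟩
  · exact .inr ⟨u, hu, k.swap, hk', hj, hui.le⟩

/-- priority relation properties: for a feasible path `φ`, if
`χ^obs_{ij} ≠ ∅` then exactly one of `i ≻ j`, `j ≻ i` holds; if `χ^obs_{ij} = ∅`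
then `i ≻ j` does not hold. -/
theorem stmt5 (n : ℕ) (hn : 1 ≤ n) (κ : Fin n → Fin n → Set (ℝ × ℝ))
    (hκ : KappaHyp n κ) (φ : ℝ → Fin n → ℝ)
    (hφ : PhiMem n (freeRegion n κ) φ) :
    (∀ i j : Fin n, cyl n κ i j ≠ ∅ → Xor' (Pri n κ φ i j) (Pri n κ φ j i)) ∧
    (∀ i j : Fin n, cyl n κ i j = ∅ → ¬ Pri n κ φ i j) := by
  constructor
  · intro i j hne
    obtain ⟨z, hz⟩ := nonempty_iff_ne_empty.2 hne
    have hij : i ≠ j := by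
      rintro rfl
      simp [cyl, hκ.2.2.2.1] at hz
    exact xor_iff_or_and_not_and _ _ |>.2
      ⟨pri_or_pri hκ hφ hij hz, not_pri_and_pri hκ hφ hij⟩
  · rintro i j he ⟨t, -, w, hw, -⟩
    exact he.subset ((hκ.2.2.2.2 _ _ _ _).1 hw)
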